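/- arXiv:1209.1415 — 2 statements merged into one kernel-verified Lean document; each statement's English description precedes it below -/
import Mathlib

section
/- Let z, w ∈ ℂ with z ≠ 0, and let M = [[z, w], [0, 0]] ∈ ℂ^{2×2}. Let N, D ∈ ℂ[X] be polynomials with N(0) = D(0) = 1 and D(z) ≠ 0. Then the matrix D(M) (polynomial evaluation of D at M) is invertible, and for every natural number n, ((D(M))⁻¹ · N(M))^n = [[Rⁿ, w·(Rⁿ − 1)/z], [0, 1]], where R = N(z)/D(z). In particular, the first component of ((D(M))⁻¹ N(M))^n applied to the vector (0, 1)ᵀ equals w·(Rⁿ − 1)/z. -/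
open Polynomial in
/-- Evaluation of a polynomial at the augmented matrix `[[z, w], [0, 0]]`. -/
theorem aeval_augmented {K : Type*} [Field K] {z : K} (hz : z ≠ 0) (w : K) (P : K[X]) :
    aeval !![z, w; 0, 0] P =
      !![P.eval z, w * (P.eval z - P.eval 0) / z; 0, P.eval 0] := by
  induction P using Polynomial.induction_on with
  | C a =>
    ext i j
    fin_cases i <;> fin_cases j <;> simp [Matrix.algebraMap_matrix_apply]
  | add P Q hP hQ =>
    rw [map_add, hP, hQ]
    ext i j
    fin_cases i <;> fin_cases j <;> simp
    ring
  | monomial n a ih =>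
    rw [pow_succ, ← mul_assoc, map_mul, ih, aeval_X]
    ext i j
    fin_cases i <;> fin_cases j <;> simp [Matrix.mul_apply, Fin.sum_univ_two] <;> field_simp

/-- Powers of `[[r, w (r - 1) / z], [0, 1]]`. -/
theorem augmented_pow {K : Type*} [Field K] (z w r : K) (n : ℕ) :
    !![r, w * (r - 1) / z; 0, 1] ^ n = !![r ^ n, w * (r ^ n - 1) / z; 0, 1] := by
  induction n with
  | zero => simp [Matrix.one_fin_two]
  | succ n ih =>
    rw [pow_succ, ih]
    ext i j
    fin_cases i <;> fin_cases j <;> simp [Matrix.mul_apply, Fin.sum_univ_two] <;> ring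

/-- On the scalar test equation, the scaled-and-squared rational (e.g. Padé) evaluation
of the augmented matrix `M = [[z, w], [0, 0]]` reduces to multiplication by the scalar
stability function `R = N(z)/D(z)`. -/
theorem rational_matrix_power_on_augmented (z w : ℂ) (hz : z ≠ 0)
    (N D : Polynomial ℂ) (hN0 : N.eval 0 = 1) (hD0 : D.eval 0 = 1)
    (hDz : D.eval z ≠ 0)
    (M : Matrix (Fin 2) (Fin 2) ℂ) (hM : M = !![z, w; 0, 0]) :
    IsUnit (Polynomial.aeval M D) ∧
    ∀ n : ℕ,
      ((Polynomial.aeval M D)⁻¹ * Polynomial.aeval M N) ^ n =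
        !![(N.eval z / D.eval z) ^ n, w * ((N.eval z / D.eval z) ^ n - 1) / z;
           0, 1] ∧
      (((Polynomial.aeval M D)⁻¹ * Polynomial.aeval M N) ^ n).mulVec ![0, 1] 0 =
        w * ((N.eval z / D.eval z) ^ n - 1) / z := by
  have hunit : IsUnit (Polynomial.aeval M D) := by
    rw [Matrix.isUnit_iff_isUnit_det, hM, aeval_augmented hz]
    simp [Matrix.det_fin_two, hD0, hDz]
  have hstep : (Polynomial.aeval M D)⁻¹ * Polynomial.aeval M N =
      !![N.eval z / D.eval z, w * (N.eval z / D.eval z - 1) / z; 0, 1] := by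
    have hdet := (Matrix.isUnit_iff_isUnit_det _).mp hunit
    have hmul : Polynomial.aeval M N = Polynomial.aeval M D *
        !![N.eval z / D.eval z, w * (N.eval z / D.eval z - 1) / z; 0, 1] := by
      rw [hM, aeval_augmented hz, aeval_augmented hz, hN0, hD0]
      ext i j
      fin_cases i <;> fin_cases j <;> simp [Matrix.mul_apply, Fin.sum_univ_two] <;>
        field_simp
      ring
    rw [hmul, Matrix.nonsing_inv_mul_cancel_left _ _ hdet]
  refine ⟨hunit, fun n => ?_⟩
  rw [hstep, augmented_pow]
  exact ⟨rfl, by simp [Matrix.mulVec, dotProduct, Fin.sum_univ_two]⟩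
end

section
/- Let f : ℝ × ℝ^d → ℝ^d be continuously differentiable with ‖f(s, x) − f(s, x')‖ ≤ 𝓛‖x − x'‖ for all s, x, x' (𝓛 > 0) and ‖f_x(s, x)‖ ≤ 𝓜 for all (s, x). Fix t_n and 0 < h < 1, let x solve x'(t) = f(t, x(t)) on [t_n, t_n + h] with x(t_n) = x_n, and set A = f_x(t_n, x_n), v = f_t(t_n, x_n), w = f(t_n, x_n). Let φ(s) be the exact increment of the linearized equation, i.e. φ(0) = 0 and φ'(s) = A(x_n + φ(s)) + v·s + w − A x_n for s ∈ [0, h]. Suppose Λ₁ : [0, h] → ℝ^d satisfies ‖φ(s) − Λ₁(s)‖ ≤ C·h^{p+q+1} for all s ∈ [0, h] (C ≥ 0, p + q ≥ 1). Let z̃₂ solve z̃₂(0) = 0, z̃₂'(s) = f(t_n + s, x_n + Λ₁(s) + z̃₂(s)) − A·Λ₁(s) − v·s − w on [0, h]. Then: (i) if Λ₂ ∈ ℝ^d satisfies ‖z̃₂(h) − Λ₂‖ ≤ C₁·h^6, then ‖x(t_n + h) − x_n − Λ₁(h) − Λ₂‖ ≤ K·h^{p+q+1} + C₁·h^6; and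 (ii) if Λ̂₂ ∈ ℝ^d satisfies ‖z̃₂(h) − Λ̂₂‖ ≤ C₂·h^5, then ‖x(t_n + h) − x_n − Λ₁(h) − Λ̂₂‖ ≤ K·h^{p+q+1} + C₂·h^5; in both cases with the constant K = C·(1 + (𝓛 + 𝓜)·𝓛^{−1}·(e^{𝓛} − 1)). -/
open Set

/-- Perturbation bound for the splitting of a flow into a linear increment `φ` and the solution
`z` of an auxiliary equation driven by an approximation `Λ` of `φ` that is accurate up to `ε`. -/
lemma norm_sub_splitting_le {E : Type*} [NormedAddCommGroup E] [NormedSpace ℝ E]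
    {f : ℝ × E → E} {L M ε t₀ h : ℝ} (hL : 0 < L)
    (hlip : ∀ (s : ℝ) (y y' : E), ‖f (s, y) - f (s, y')‖ ≤ L * ‖y - y'‖)
    (hh0 : 0 ≤ h) {x₀ : E} {x : ℝ → E} (hx0 : x t₀ = x₀)
    (hx : ∀ t ∈ Icc t₀ (t₀ + h), HasDerivAt x (f (t, x t)) t)
    {A : E →L[ℝ] E} (hA : ‖A‖ ≤ M) {v w : E} {φ : ℝ → E} (hφ0 : φ 0 = 0)
    (hφ : ∀ s ∈ Icc (0 : ℝ) h, HasDerivAt φ (A (x₀ + φ s) + s • v + w - A x₀) s)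
    {Λ : ℝ → E} (hΛ : ∀ s ∈ Icc (0 : ℝ) h, ‖φ s - Λ s‖ ≤ ε)
    {z : ℝ → E} (hz0 : z 0 = 0)
    (hz : ∀ s ∈ Icc (0 : ℝ) h,
      HasDerivAt z (f (t₀ + s, x₀ + Λ s + z s) - A (Λ s) - s • v - w) s) :
    ‖x (t₀ + h) - x₀ - φ h - z h‖ ≤ (L + M) * ε / L * (Real.exp (L * h) - 1) := by
  have hderiv : ∀ s ∈ Icc (0 : ℝ) h,
      HasDerivAt (fun s => x (t₀ + s) - x₀ - φ s - z s)
        (f (t₀ + s, x (t₀ + s)) - f (t₀ + s, x₀ + Λ s + z s) - A (φ s - Λ s)) s := by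
    intro s hs
    have hxs : HasDerivAt (fun s => x (t₀ + s)) (f (t₀ + s, x (t₀ + s))) s :=
      (hx (t₀ + s) ⟨by linarith [hs.1], by linarith [hs.2]⟩).comp_const_add t₀ s
    convert! ((hxs.sub_const x₀).sub (hφ s hs)).sub (hz s hs) using 1
    simp only [map_add, map_sub]
    abel
  have hbound : ∀ s ∈ Ico (0 : ℝ) h,
      ‖f (t₀ + s, x (t₀ + s)) - f (t₀ + s, x₀ + Λ s + z s) - A (φ s - Λ s)‖ ≤
        L * ‖x (t₀ + s) - x₀ - φ s - z s‖ + (L + M) * ε := by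
    intro s hs
    have hε := hΛ s (Ico_subset_Icc_self hs)
    have hdist : ‖x (t₀ + s) - (x₀ + Λ s + z s)‖ ≤ ‖x (t₀ + s) - x₀ - φ s - z s‖ + ε := by
      calc ‖x (t₀ + s) - (x₀ + Λ s + z s)‖
          = ‖(x (t₀ + s) - x₀ - φ s - z s) + (φ s - Λ s)‖ := by congr 1; abel
        _ ≤ _ := (norm_add_le _ _).trans (by gcongr)
    calc ‖f (t₀ + s, x (t₀ + s)) - f (t₀ + s, x₀ + Λ s + z s) - A (φ s - Λ s)‖
        ≤ ‖f (t₀ + s, x (t₀ + s)) - f (t₀ + s, x₀ + Λ s + z s)‖ + ‖A (φ s - Λ s)‖ :=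
          norm_sub_le _ _
      _ ≤ L * (‖x (t₀ + s) - x₀ - φ s - z s‖ + ε) + M * ε :=
          add_le_add ((hlip _ _ _).trans (by gcongr))
            (A.le_of_opNorm_le_of_le hA hε)
      _ = _ := by ring
  have hgronwall := norm_le_gronwallBound_of_norm_deriv_right_le (δ := 0)
    (fun s hs => (hderiv s hs).continuousAt.continuousWithinAt)
    (fun s hs => (hderiv s (Ico_subset_Icc_self hs)).hasDerivWithinAt)
    (by simp [hx0, hφ0, hz0]) hbound h (right_mem_Icc.2 hh0)
  simpa [gronwallBound_of_K_ne_0 hL.ne'] using hgronwall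

/-- Local truncation error of the embedded Locally Linearized Runge-Kutta formulas:
the step is the sum of a Local Linearization approximation `Λ₁` (local error of order
`p+q+1`) and a Runge-Kutta approximation `Λ₂` (resp. `Λ̂₂`) of the auxiliary nonlinear
equation (local error of order 6, resp. 5). -/
theorem llrk_local_truncation_error {d : ℕ} (f : ℝ × (Fin d → ℝ) → (Fin d → ℝ))
    (hf : ContDiff ℝ 1 f) (𝓛 𝓜 : ℝ) (h𝓛 : 0 < 𝓛)
    (hlip : ∀ (s : ℝ) (x x' : Fin d → ℝ), ‖f (s, x) - f (s, x')‖ ≤ 𝓛 * ‖x - x'‖)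
    (hbdd : ∀ (s : ℝ) (x : Fin d → ℝ), ‖fderiv ℝ (fun y => f (s, y)) x‖ ≤ 𝓜)
    (tn : ℝ) (h : ℝ) (hh0 : 0 < h) (hh1 : h < 1)
    (xn : Fin d → ℝ) (x : ℝ → (Fin d → ℝ))
    (hx0 : x tn = xn)
    (hx : ∀ t ∈ Icc tn (tn + h), HasDerivAt x (f (t, x t)) t)
    (A : (Fin d → ℝ) →L[ℝ] (Fin d → ℝ)) (v w : Fin d → ℝ)
    (hA : A = fderiv ℝ (fun y => f (tn, y)) xn)
    (hv : v = deriv (fun t => f (t, xn)) tn)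
    (hw : w = f (tn, xn))
    (φ : ℝ → (Fin d → ℝ)) (hφ0 : φ 0 = 0)
    (hφ : ∀ s ∈ Icc (0 : ℝ) h, HasDerivAt φ (A (xn + φ s) + s • v + w - A xn) s)
    (Λ₁ : ℝ → (Fin d → ℝ)) (C : ℝ) (hC : 0 ≤ C) (p q : ℕ) (hpq : 1 ≤ p + q)
    (hΛ₁ : ∀ s ∈ Icc (0 : ℝ) h, ‖φ s - Λ₁ s‖ ≤ C * h ^ (p + q + 1))
    (z₂ : ℝ → (Fin d → ℝ)) (hz₂0 : z₂ 0 = 0)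
    (hz₂ : ∀ s ∈ Icc (0 : ℝ) h,
      HasDerivAt z₂ (f (tn + s, xn + Λ₁ s + z₂ s) - A (Λ₁ s) - s • v - w) s)
    (C₁ C₂ : ℝ) :
    (∀ Λ₂ : Fin d → ℝ, ‖z₂ h - Λ₂‖ ≤ C₁ * h ^ 6 →
      ‖x (tn + h) - xn - Λ₁ h - Λ₂‖ ≤
        C * (1 + (𝓛 + 𝓜) * 𝓛⁻¹ * (Real.exp 𝓛 - 1)) * h ^ (p + q + 1) + C₁ * h ^ 6) ∧
    (∀ Λ₂' : Fin d → ℝ, ‖z₂ h - Λ₂'‖ ≤ C₂ * h ^ 5 →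
      ‖x (tn + h) - xn - Λ₁ h - Λ₂'‖ ≤
        C * (1 + (𝓛 + 𝓜) * 𝓛⁻¹ * (Real.exp 𝓛 - 1)) * h ^ (p + q + 1) + C₂ * h ^ 5) := by
  have hM : 0 ≤ 𝓜 := (norm_nonneg _).trans (hbdd tn xn)
  have hsplit := norm_sub_splitting_le h𝓛 hlip hh0.le hx0 hx (hA ▸ hbdd tn xn) hφ0 hφ hΛ₁ hz₂0 hz₂
  have hexp : Real.exp (𝓛 * h) ≤ Real.exp 𝓛 :=
    Real.exp_le_exp.2 (mul_le_of_le_one_right h𝓛.le hh1.le)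
  have hlocal : ‖x (tn + h) - xn - Λ₁ h - z₂ h‖ ≤
      C * (1 + (𝓛 + 𝓜) * 𝓛⁻¹ * (Real.exp 𝓛 - 1)) * h ^ (p + q + 1) := by
    calc ‖x (tn + h) - xn - Λ₁ h - z₂ h‖
        = ‖(x (tn + h) - xn - φ h - z₂ h) + (φ h - Λ₁ h)‖ := by congr 1; abel
      _ ≤ (𝓛 + 𝓜) * (C * h ^ (p + q + 1)) / 𝓛 * (Real.exp 𝓛 - 1) + C * h ^ (p + q + 1) := by
          refine (norm_add_le _ _).trans (add_le_add (hsplit.trans ?_)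
            (hΛ₁ h (right_mem_Icc.2 hh0.le)))
          gcongr
      _ = _ := by ring
  have hstep : ∀ (Λ : Fin d → ℝ) (δ : ℝ), ‖z₂ h - Λ‖ ≤ δ → ‖x (tn + h) - xn - Λ₁ h - Λ‖ ≤
      C * (1 + (𝓛 + 𝓜) * 𝓛⁻¹ * (Real.exp 𝓛 - 1)) * h ^ (p + q + 1) + δ := by
    intro Λ δ hδ
    calc ‖x (tn + h) - xn - Λ₁ h - Λ‖
        = ‖(x (tn + h) - xn - Λ₁ h - z₂ h) + (z₂ h - Λ)‖ := by congr 1; abel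
      _ ≤ _ := (norm_add_le _ _).trans (add_le_add hlocal hδ)
  exact ⟨fun Λ₂ => hstep Λ₂ _, fun Λ₂' => hstep Λ₂' _⟩
end
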